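/- arXiv:1304.1448 — 2 statements merged into one kernel-verified Lean document; each statement's English description precedes it below -/
import Mathlib

section
/- Let s̄ ∈ S^n, let j ∈ {0,1}^n, and let i ≠ i' be two elements of {0,1}^n. If the leaves f^j_i ∈ L_s̄(x) and f^j_{i'} ∈ L_s̄(x') both exist, then x ≠ x'. -/
/-!
STATEMENT 4.  In the light leaves tree `T_s̄` for a word `s̄ ∈ S^n`, each leaf is encoded by a
pair `(i, j) ∈ {0,1}^n × {0,1}^n` and is completely determined by `i` alone: the bit `i_k`
records whether a morphism of type `m_{s_k}` occurs at step `k`, and `j_k` records whether a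
morphism of type `j_{s_k}` occurs at step `k`.  Combinatorially, a leaf with subscript `i`
determines the sequence `y_0 = e, y_1, …, y_n` of group elements attached to the nodes of the
corresponding branch: at step `k`, if `ℓ(y_{k−1} s_k) > ℓ(y_{k−1})` then `j_k = 0` and
`y_k = y_{k−1}` when `i_k = 1` (an `m` occurs, the letter is dropped) and
`y_k = y_{k−1} s_k` when `i_k = 0`; if `ℓ(y_{k−1} s_k) < ℓ(y_{k−1})` then `j_k = 1` and
`y_k = y_{k−1} s_k` when `i_k = 1` and `y_k = y_{k−1}` when `i_k = 0`.  The target of the leaf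
`f^j_i` is `x = y_n`.

The statement (Lemma `IJ`): if `i ≠ i'` are two subscripts with the same superscript `j`
(i.e. the leaves `f^j_i ∈ L_s̄(x)` and `f^j_{i'} ∈ L_s̄(x')` both exist), then `x ≠ x'`.
-/

variable {B : Type*} {W : Type*} [Group W] {M : CoxeterMatrix B}

/-- One step in the branch of the light leaves tree determined by the bit `p.2`:
if `(ℓ(y s) > ℓ(y)) = p.2` the current group element is kept, otherwise it is
multiplied by the simple reflection. -/
noncomputable def leafStep (cs : CoxeterSystem M W) (y : W) (p : B × Bool) : W :=
  if (decide (cs.length y < cs.length (y * cs.simple p.1)) = p.2) then y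
  else y * cs.simple p.1

/-- The element `x ∈ W` (the label of the target Bott–Samelson `B_x̄`) of the leaf `f^j_i`
of `T_s̄` with subscript `i`. -/
noncomputable def leafTarget (cs : CoxeterSystem M W) (s : List B) (i : List Bool) : W :=
  (s.zip i).foldl (leafStep cs) 1

/-- The superscript `j ∈ {0,1}^n` of the leaf of `T_s̄` with subscript `i`:
`j_k = 1` exactly when `ℓ(y_{k−1} s_k) < ℓ(y_{k−1})`, i.e. when a morphism of type `j_s`
occurs at step `k`. -/
noncomputable def leafJCode (cs : CoxeterSystem M W) (s : List B) (i : List Bool) : List Bool :=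
  ((s.zip i).foldl
    (fun st p =>
      (st.1 ++ [decide (cs.length (st.2 * cs.simple p.1) < cs.length st.2)],
        leafStep cs st.2 p))
    (([] : List Bool), (1 : W))).1

theorem leafFold_snd (cs : CoxeterSystem M W) (l : List (B × Bool)) (a : List Bool) (y : W) :
    (l.foldl
    (fun st p =>
      (st.1 ++ [decide (cs.length (st.2 * cs.simple p.1) < cs.length st.2)],
        leafStep cs st.2 p))
    (a, y)).2 = l.foldl (leafStep cs) y := by
  induction l generalizing a y with
  | nil => rfl
  | cons p l ih => simp only [List.foldl_cons]; exact ih _ _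

theorem leafTarget_snoc (cs : CoxeterSystem M W) (s : List B) (i : List Bool) (b : B) (c : Bool)
    (h : i.length = s.length) :
    leafTarget cs (s ++ [b]) (i ++ [c]) = leafStep cs (leafTarget cs s i) (b, c) := by
  unfold leafTarget
  rw [List.zip_append h.symm, List.foldl_append]
  rfl

theorem leafJCode_snoc (cs : CoxeterSystem M W) (s : List B) (i : List Bool) (b : B) (c : Bool)
    (h : i.length = s.length) :
    leafJCode cs (s ++ [b]) (i ++ [c]) = leafJCode cs s i ++
      [decide (cs.length (leafTarget cs s i * cs.simple b) < cs.length (leafTarget cs s i))] := by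
  unfold leafJCode leafTarget
  rw [List.zip_append h.symm, List.foldl_append, ← leafFold_snd cs _ []]
  rfl

theorem leafStep_inj (cs : CoxeterSystem M W) (y z : W) (b : B) (c d : Bool)
    (hj : cs.length (y * cs.simple b) < cs.length y ↔ cs.length (z * cs.simple b) < cs.length z)
    (h : leafStep cs y (b, c) = leafStep cs z (b, d)) : y = z ∧ c = d := by
  have hne : ∀ w : W, w * cs.simple b ≠ w := by
    intro w hw
    have := cs.length_mul_simple_ne w b
    rw [hw] at this
    exact this rfl
  have hyz : y = z := by
    unfold leafStep at h
    have h1 := cs.length_mul_simple_ne y b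
    have h2 := cs.length_mul_simple_ne z b
    split_ifs at h with p q q
    · exact h
    · subst h
      simp only [cs.simple_mul_simple_cancel_right] at hj h1
      omega
    · subst h
      simp only [cs.simple_mul_simple_cancel_right] at hj h2
      omega
    · exact mul_right_cancel h
  subst hyz
  refine ⟨rfl, ?_⟩
  unfold leafStep at h
  split_ifs at h with p q q
  · exact p.symm.trans q
  · exact absurd h.symm (hne y)
  · exact absurd h (hne y)
  · revert p q
    generalize decide (cs.length y < cs.length (y * cs.simple b)) = e
    clear h hj
    revert c d e
    simp only
    decide

theorem leaf_inj (cs : CoxeterSystem M W) (s : List B) : ∀ (i i' : List Bool)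
    (_ : i.length = s.length) (_ : i'.length = s.length)
    (_ : leafJCode cs s i = leafJCode cs s i')
    (_ : leafTarget cs s i = leafTarget cs s i'), i = i' := by
  induction s using List.reverseRecOn with
  | nil =>
    intro i i' hi hi' _ _
    rw [List.length_eq_zero_iff.mp hi, List.length_eq_zero_iff.mp hi']
  | append_singleton s b ih =>
    intro i i' hi hi' hj ht
    rcases List.eq_nil_or_concat' i with rfl | ⟨i, c, rfl⟩
    · simp at hi
    rcases List.eq_nil_or_concat' i' with rfl | ⟨i', d, rfl⟩
    · simp at hi'
    simp only [List.length_append, List.length_singleton, Nat.add_right_cancel_iff] at hi hi'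
    rw [leafJCode_snoc cs s i b c hi, leafJCode_snoc cs s i' b d hi'] at hj
    rw [leafTarget_snoc cs s i b c hi, leafTarget_snoc cs s i' b d hi'] at ht
    obtain ⟨hj1, hj2⟩ := List.append_inj' hj rfl
    simp only [List.cons.injEq, and_true, decide_eq_decide] at hj2
    obtain ⟨h1, h2⟩ := leafStep_inj cs _ _ b c d hj2 ht
    rw [ih i i' hi hi' hj1 h1, h2]

/-- Lemma `IJ`: two distinct subscripts `i ≠ i'` with the same superscript `j`
give leaves with distinct targets `x ≠ x'`. -/
theorem statement4 (cs : CoxeterSystem M W) (s : List B) (i i' : List Bool)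
    (hi : i.length = s.length) (hi' : i'.length = s.length)
    (hne : i ≠ i')
    (hj : leafJCode cs s i = leafJCode cs s i') :
    leafTarget cs s i ≠ leafTarget cs s i' := by
  exact fun ht => hne (leaf_inj cs s i i' hi hi' hj ht)
end

section
/- Let (y_p)_{p=0}^n and (y'_p)_{p=0}^n be sequences in W with y_0 = y'_0 = e and, for each 1 ≤ p ≤ n, y_p ∈ {y_{p−1}, y_{p−1}s_p} and y'_p ∈ {y'_{p−1}, y'_{p−1}s_p}. Assume that for every 1 ≤ p ≤ n one has ℓ(y_{p−1}s_p) = ℓ(y_{p−1}) − 1 if and only if ℓ(y'_{p−1}s_p) = ℓ(y'_{p−1}) − 1. If y_n = y'_n, then y_p = y'_p for all 0 ≤ p ≤ n. -/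
/-!
STATEMENT 5.  Let `(W,S)` be a Coxeter system with length function `ℓ` and identity `e`,
`n ≥ 0` and `s_1, …, s_n ∈ S`.  Let `(y_p)` and `(y'_p)` be sequences in `W` with
`y_0 = y'_0 = e`, each `y_p ∈ {y_{p−1}, y_{p−1} s_p}` (and likewise for `y'`).  Assume that
for each `1 ≤ p ≤ n` one has `ℓ(y_{p−1} s_p) = ℓ(y_{p−1}) − 1` iff
`ℓ(y'_{p−1} s_p) = ℓ(y'_{p−1}) − 1` (expressed subtraction-free as
`ℓ(y_{p−1} s_p) + 1 = ℓ(y_{p−1})`).  If `y_n = y'_n` then `y_p = y'_p` for all `p`.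
-/
theorem statement5 {B : Type*} {W : Type*} [Group W] {M : CoxeterMatrix B}
    (cs : CoxeterSystem M W) (n : ℕ) (s : Fin n → B)
    (y y' : Fin (n + 1) → W)
    (h0 : y 0 = 1) (h0' : y' 0 = 1)
    (hstep : ∀ p : Fin n, y p.succ = y p.castSucc ∨
      y p.succ = y p.castSucc * cs.simple (s p))
    (hstep' : ∀ p : Fin n, y' p.succ = y' p.castSucc ∨
      y' p.succ = y' p.castSucc * cs.simple (s p))
    (hlen : ∀ p : Fin n,
      (cs.length (y p.castSucc * cs.simple (s p)) + 1 = cs.length (y p.castSucc) ↔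
        cs.length (y' p.castSucc * cs.simple (s p)) + 1 = cs.length (y' p.castSucc)))
    (hend : y (Fin.last n) = y' (Fin.last n)) :
    ∀ p : Fin (n + 1), y p = y' p := by
  intro p
  have key : ∀ (w : W) (i : B),
      ¬ (cs.length (w * cs.simple i) + 1 = cs.length w ↔
        cs.length (w * cs.simple i * cs.simple i) + 1 = cs.length (w * cs.simple i)) := by
    intro w i
    have h := cs.length_mul_simple w i
    rw [mul_assoc, cs.simple_mul_simple_self, mul_one]
    omega
  induction p using Fin.reverseInduction with
  | last => exact hend
  | cast p ih =>
    have hl := hlen p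
    rcases hstep p with h | h <;> rcases hstep' p with h' | h' <;> rw [h, h'] at ih
    · exact ih
    · rw [ih] at hl
      exact absurd hl.symm (key _ _)
    · rw [← ih] at hl
      exact absurd hl (key _ _)
    · exact mul_right_cancel ih
end
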